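/- Let G=(V,F,E) with V=[n] be a random bipartite graph whose distribution is invariant under permutations of the variable nodes, carrying an observation system, and let μ_i(·) = P{X_i = · | Y, Z} be the conditional marginals, viewed as random elements of 𝖬(𝒳). Then for any diverging sequence R₀ ⊆ ℕ there exist a subsequence R ⊆ R₀ and a probability distribution S on 𝖬²(𝒳) such that, for every k, every set of distinct variable nodes {i(1),…,i(k)} ⊆ [n], and every bounded Lipschitz function φ : 𝖬(𝒳)^k → ℝ: lim_{n∈R} E_G E{ φ(μ_{i(1)},…,μ_{i(k)}) } = ∫ [ ∫ φ(μ₁,…,μ_k) ρ(dμ₁)⋯ρ(dμ_k) ] S(dρ). -/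

import Mathlib

open Finset MeasureTheory Filter

namespace PaperObs

/-- Reveal-perturbation factor for the perturbed observation `Z_i(θ)`:
`Z_i(θ) = (Z_i, X_i)` with probability `θ` and `(Z_i, ∗)` with probability `1-θ`,
where `∗` is encoded by `Option.none`. -/
def pert {𝒳 : Type*} [DecidableEq 𝒳] (θ : ℝ) (o : Option 𝒳) (x : 𝒳) : ℝ :=
  if o = some x then θ else if o = none then 1 - θ else 0

section Core

variable {V F 𝒳 𝒴 𝒵 : Type*} [Fintype V] [Fintype F] [Fintype 𝒳] [Fintype 𝒴] [Fintype 𝒵]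
  [DecidableEq V] [DecidableEq F] [DecidableEq 𝒳] [DecidableEq 𝒴]

/-- Joint density of `(X, Y_{S_F}, Z_{S_V}(θ))` in an observation system, where only the
observations `Y_a`, `a ∈ SF`, and `Z_i(θᵥ i)`, `i ∈ SV`, are kept (the others being
marginalized out), and where the perturbation parameter is allowed to depend on the node. -/
def jointSub (p : 𝒳 → ℝ) (Q : F → 𝒴 → (V → 𝒳) → ℝ) (R : 𝒵 → 𝒳 → ℝ) (θv : V → ℝ)
    (SF : Finset F) (SV : Finset V)
    (x : V → 𝒳) (y : F → 𝒴) (z : V → 𝒵 × Option 𝒳) : ℝ :=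
  (∏ i, p (x i)) * (∏ a ∈ SF, Q a (y a) x) *
    ∏ i ∈ SV, (R (z i).1 (x i) * pert (θv i) (z i).2 (x i))

/-- Conditional probability `P{X_{i(1)} = ξ₁, …, X_{i(k)} = ξ_k | Y_{SF}, Z_{SV}(θ)}`. -/
noncomputable def condPTuple (p : 𝒳 → ℝ) (Q : F → 𝒴 → (V → 𝒳) → ℝ) (R : 𝒵 → 𝒳 → ℝ)
    (θv : V → ℝ) (SF : Finset F) (SV : Finset V) {k : ℕ} (ii : Fin k → V) (ξ : Fin k → 𝒳)
    (y : F → 𝒴) (z : V → 𝒵 × Option 𝒳) : ℝ :=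
  (∑ x : V → 𝒳, if ∀ l, x (ii l) = ξ l then jointSub p Q R θv SF SV x y z else 0) /
    ∑ x : V → 𝒳, jointSub p Q R θv SF SV x y z

/-- Conditional probability `P{X_U = ξ_U | Y_{SF}, Z_{SV}(θ)}` for a set `U` of variable
nodes. -/
noncomputable def condPOn (p : 𝒳 → ℝ) (Q : F → 𝒴 → (V → 𝒳) → ℝ) (R : 𝒵 → 𝒳 → ℝ)
    (θv : V → ℝ) (SF : Finset F) (SV : Finset V) (U : Finset V) (ξ : {v // v ∈ U} → 𝒳)
    (y : F → 𝒴) (z : V → 𝒵 × Option 𝒳) : ℝ :=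
  (∑ x : V → 𝒳, if ∀ l : {v // v ∈ U}, x l.1 = ξ l then jointSub p Q R θv SF SV x y z else 0) /
    ∑ x : V → 𝒳, jointSub p Q R θv SF SV x y z

/-- One-variable conditional marginal `P{X_i = ξ | Y_{SF}, Z_{SV}(θ)}`. -/
noncomputable def margP (p : 𝒳 → ℝ) (Q : F → 𝒴 → (V → 𝒳) → ℝ) (R : 𝒵 → 𝒳 → ℝ)
    (θv : V → ℝ) (SF : Finset F) (SV : Finset V) (i : V) (ξ : 𝒳)
    (y : F → 𝒴) (z : V → 𝒵 × Option 𝒳) : ℝ :=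
  condPTuple p Q R θv SF SV (fun _ : Fin 1 => i) (fun _ => ξ) y z

/-- Total variation distance between the joint conditional law of
`(X_{i(1)}, …, X_{i(k)})` given the observations and the product of its marginals. -/
noncomputable def tvTuple (p : 𝒳 → ℝ) (Q : F → 𝒴 → (V → 𝒳) → ℝ) (R : 𝒵 → 𝒳 → ℝ)
    (θv : V → ℝ) (SF : Finset F) (SV : Finset V) {k : ℕ} (ii : Fin k → V)
    (y : F → 𝒴) (z : V → 𝒵 × Option 𝒳) : ℝ :=
  2⁻¹ * ∑ ξ : Fin k → 𝒳,
    |condPTuple p Q R θv SF SV ii ξ y z - ∏ l, margP p Q R θv SF SV (ii l) (ξ l) y z|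

/-- Total variation distance between the joint conditional law of `X_U` given the
observations and the product of its marginals. -/
noncomputable def tvOn (p : 𝒳 → ℝ) (Q : F → 𝒴 → (V → 𝒳) → ℝ) (R : 𝒵 → 𝒳 → ℝ)
    (θv : V → ℝ) (SF : Finset F) (SV : Finset V) (U : Finset V)
    (y : F → 𝒴) (z : V → 𝒵 × Option 𝒳) : ℝ :=
  2⁻¹ * ∑ ξ : {v // v ∈ U} → 𝒳,
    |condPOn p Q R θv SF SV U ξ y z - ∏ l : {v // v ∈ U}, margP p Q R θv SF SV l.1 (ξ l) y z|

/-- Expectation, over the observations `(Y, Z(θ))`, of a function `f` of the observations. -/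
noncomputable def expObs (p : 𝒳 → ℝ) (Q : F → 𝒴 → (V → 𝒳) → ℝ) (R : 𝒵 → 𝒳 → ℝ)
    (θv : V → ℝ) (f : (F → 𝒴) → (V → 𝒵 × Option 𝒳) → ℝ) : ℝ :=
  ∑ y : F → 𝒴, ∑ z : V → 𝒵 × Option 𝒳,
    (∑ x : V → 𝒳, jointSub p Q R θv univ univ x y z) * f y z

/-- Shannon entropy `H(X₁)` of a single variable with law `p`. -/
noncomputable def Hp (p : 𝒳 → ℝ) : ℝ := ∑ x, Real.negMulLog (p x)

/-- Conditional Shannon entropy `H(X | Y, Z(θ))` of the full hidden vector given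
the observations, computed as `H(X, (Y,Z(θ))) - H(Y, Z(θ))`. -/
noncomputable def condEnt (p : 𝒳 → ℝ) (Q : F → 𝒴 → (V → 𝒳) → ℝ) (R : 𝒵 → 𝒳 → ℝ)
    (θv : V → ℝ) : ℝ :=
  (∑ x : V → 𝒳, ∑ y : F → 𝒴, ∑ z : V → 𝒵 × Option 𝒳,
      Real.negMulLog (jointSub p Q R θv univ univ x y z)) -
    ∑ y : F → 𝒴, ∑ z : V → 𝒵 × Option 𝒳,
      Real.negMulLog (∑ x : V → 𝒳, jointSub p Q R θv univ univ x y z)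

/-- Conditional Shannon entropy `H(X_i | Y, Z(θ))` of a single variable given the
observations. -/
noncomputable def condEnt1 (p : 𝒳 → ℝ) (Q : F → 𝒴 → (V → 𝒳) → ℝ) (R : 𝒵 → 𝒳 → ℝ)
    (θv : V → ℝ) (i : V) : ℝ :=
  (∑ ξ : 𝒳, ∑ y : F → 𝒴, ∑ z : V → 𝒵 × Option 𝒳,
      Real.negMulLog (∑ x : V → 𝒳, if x i = ξ then jointSub p Q R θv univ univ x y z else 0)) -
    ∑ y : F → 𝒴, ∑ z : V → 𝒵 × Option 𝒳,
      Real.negMulLog (∑ x : V → 𝒳, jointSub p Q R θv univ univ x y z)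

/-- Conditional mutual information `I(X_i ; X_j | Y, Z(θ))`. -/
noncomputable def condMI (p : 𝒳 → ℝ) (Q : F → 𝒴 → (V → 𝒳) → ℝ) (R : 𝒵 → 𝒳 → ℝ)
    (θv : V → ℝ) (i j : V) : ℝ :=
  ∑ y : F → 𝒴, ∑ z : V → 𝒵 × Option 𝒳, ∑ ξ₁ : 𝒳, ∑ ξ₂ : 𝒳,
    (∑ x : V → 𝒳, if x i = ξ₁ ∧ x j = ξ₂ then jointSub p Q R θv univ univ x y z else 0) *
      Real.log
        (((∑ x : V → 𝒳, if x i = ξ₁ ∧ x j = ξ₂ then jointSub p Q R θv univ univ x y z else 0) *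
            ∑ x : V → 𝒳, jointSub p Q R θv univ univ x y z) /
          ((∑ x : V → 𝒳, if x i = ξ₁ then jointSub p Q R θv univ univ x y z else 0) *
            ∑ x : V → 𝒳, if x j = ξ₂ then jointSub p Q R θv univ univ x y z else 0))

/-- `p` is a probability distribution on the finite alphabet `𝒳`. -/
def IsPdist (p : 𝒳 → ℝ) : Prop := (∀ x, 0 ≤ p x) ∧ ∑ x, p x = 1

/-- The function-node observation kernels are genuine probability kernels. -/
def IsKernelQ (Q : F → 𝒴 → (V → 𝒳) → ℝ) : Prop :=
  (∀ a y x, 0 ≤ Q a y x) ∧ ∀ a x, ∑ y, Q a y x = 1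

/-- The single-variable observation kernel is a genuine probability kernel. -/
def IsKernelR (R : 𝒵 → 𝒳 → ℝ) : Prop :=
  (∀ z x, 0 ≤ R z x) ∧ ∀ x, ∑ z, R z x = 1

/-- Neighborhood `∂a` of a function node in the bipartite graph `g`. -/
def nbr (g : V → F → Bool) (a : F) : Finset V := univ.filter fun i => g i a = true

/-- `Y_a` depends on `X` only through `X_{∂a}`. -/
def QLocal (g : V → F → Bool) (Q : F → 𝒴 → (V → 𝒳) → ℝ) : Prop :=
  ∀ a y x x', (∀ i ∈ nbr g a, x i = x' i) → Q a y x = Q a y x'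

/-- The kernel of `Y_a` is invariant under permutations of its arguments `x_{∂a}`. -/
def QSym (g : V → F → Bool) (Q : F → 𝒴 → (V → 𝒳) → ℝ) : Prop :=
  ∀ a y (x : V → 𝒳) (σ : Equiv.Perm V), (∀ i, g i a = g (σ i) a) → Q a y (x ∘ σ) = Q a y x

/-- A probability kernel `T` (with finite output alphabet `𝒜`) from `β` is `M`-soft:
mutual absolute continuity of the rows together with the bound
`∑_y (T(y|x₁)/T(y|x₂)) T(y|x) ≤ M`. -/
def SoftKer {𝒜 β : Type*} [Fintype 𝒜] (M : ℝ) (T : 𝒜 → β → ℝ) : Prop :=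
  (∀ y x₁ x₂, T y x₂ = 0 → T y x₁ = 0) ∧
    ∀ x x₁ x₂, ∑ y, T y x₁ / T y x₂ * T y x ≤ M

/-- Weight of the bipartite graph `g` in the ensemble where each edge is present
independently with probability `pe`. -/
def gW (pe : ℝ) (g : V → F → Bool) : ℝ := ∏ i, ∏ a, if g i a then pe else 1 - pe

/-- Expectation over the random bipartite graph with iid edges of probability `pe`. -/
noncomputable def expG (pe : ℝ) (f : (V → F → Bool) → ℝ) : ℝ :=
  ∑ g : V → F → Bool, gW pe g * f g

/-- A degree-indexed family of observation kernels `Q^{(k)}(·|x_1,…,x_k)`: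
nonnegative, normalized, and invariant under permutations of the arguments. -/
def IsQFam (Qf : ∀ k : ℕ, 𝒴 → (Fin k → 𝒳) → ℝ) : Prop :=
  (∀ k y v, 0 ≤ Qf k y v) ∧ (∀ k v, ∑ y, Qf k y v = 1) ∧
    ∀ k y (v : Fin k → 𝒳) (σ : Equiv.Perm (Fin k)), Qf k y (v ∘ σ) = Qf k y v

/-- The kernel of the observation `Y_a` induced on the graph `g` by the degree-indexed
family `Qf`: it is `Q^{(|∂a|)}` applied to `x_{∂a}`. -/
def QG [LinearOrder V] (Qf : ∀ k : ℕ, 𝒴 → (Fin k → 𝒳) → ℝ) (g : V → F → Bool) (a : F)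
    (y : 𝒴) (x : V → 𝒳) : ℝ :=
  Qf ((nbr g a).sort (· ≤ ·)).length y fun l => x (((nbr g a).sort (· ≤ ·)).get l)

/-- Variable nodes within (graph) distance `t` of the variable node `i`, where distance
is measured by the number of function nodes traversed. -/
def varBall (g : V → F → Bool) (i : V) : ℕ → Finset V
  | 0 => {i}
  | t+1 => varBall g i t ∪
      univ.filter fun j => ∃ a, g j a = true ∧ ∃ k ∈ varBall g i t, g k a = true

/-- Function nodes of the radius-`t` neighbourhood of `i`: those adjacent to a variable
node at distance at most `t - 1` from `i`. -/
def funBall (g : V → F → Bool) (i : V) : ℕ → Finset F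
  | 0 => ∅
  | t+1 => univ.filter fun a => ∃ j ∈ varBall g i t, g j a = true

end Core

end PaperObs
namespace PaperObs

/-- The space `𝖬(𝒳)` of probability measures on the finite alphabet `𝒳`, as the
standard simplex of probability vectors (with its Borel structure and metric inherited
from `𝒳 → ℝ`). -/
abbrev MX (𝒳 : Type*) [Fintype 𝒳] : Type _ :=
  {f : 𝒳 → ℝ // (∀ x, 0 ≤ f x) ∧ ∑ x, f x = 1}

/-- The uniform element of `𝖬(𝒳)` (used as a junk value). -/
noncomputable def unifMX (𝒳 : Type*) [Fintype 𝒳] [Nonempty 𝒳] : MX 𝒳 :=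
  ⟨fun _ => (Fintype.card 𝒳 : ℝ)⁻¹, fun _ => by positivity, by
    have h : (Fintype.card 𝒳 : ℝ) ≠ 0 := Nat.cast_ne_zero.2 Fintype.card_ne_zero
    simp [Finset.sum_const, Finset.card_univ, nsmul_eq_mul, mul_inv_cancel₀ h]⟩

/-- Normalization of a nonnegative, not identically zero function on `𝒳` to an element
of `𝖬(𝒳)` (junk value: the uniform distribution). -/
noncomputable def normMX {𝒳 : Type*} [Fintype 𝒳] [Nonempty 𝒳] (f : 𝒳 → ℝ) : MX 𝒳 :=
  if h : (∀ x, 0 ≤ f x) ∧ 0 < ∑ x, f x then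
    ⟨fun x => f x / ∑ x', f x', fun x => div_nonneg (h.1 x) h.2.le, by
      rw [← Finset.sum_div, div_self (ne_of_gt h.2)]⟩
  else unifMX 𝒳

/-- The conditional marginal `P{X_i = · | Y_{SF}, Z_{SV}(θ)}` as an element of `𝖬(𝒳)`. -/
noncomputable def margMX {V F 𝒳 𝒴 𝒵 : Type*} [Fintype V] [Fintype F] [Fintype 𝒳]
    [Fintype 𝒴] [Fintype 𝒵] [DecidableEq V] [DecidableEq F] [DecidableEq 𝒳]
    [DecidableEq 𝒴] [Nonempty 𝒳]
    (p : 𝒳 → ℝ) (Q : F → 𝒴 → (V → 𝒳) → ℝ) (R : 𝒵 → 𝒳 → ℝ) (θv : V → ℝ)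
    (SF : Finset F) (SV : Finset V) (i : V) (y : F → 𝒴) (z : V → 𝒵 × Option 𝒳) : MX 𝒳 :=
  normMX fun ξ => ∑ x : V → 𝒳, if x i = ξ then jointSub p Q R θv SF SV x y z else 0

/-- The law of a vector of `k` iid samples from `ρ`. -/
noncomputable def iidVec {𝒳 : Type*} [Fintype 𝒳] (ρ : MeasureTheory.Measure (MX 𝒳)) :
    (k : ℕ) → MeasureTheory.Measure (Fin k → MX 𝒳)
  | 0 => MeasureTheory.Measure.dirac fun i => i.elim0
  | k+1 => ρ.bind fun ν => (iidVec ρ k).map (Fin.cons ν)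

end PaperObs
namespace PaperObs

open Topology


section Giry

lemma measurable_integral_giry {E : Type*} [MeasurableSpace E] {f : E → ℝ}
    (hf : StronglyMeasurable f) :
    Measurable fun μ : ProbabilityMeasure E => ∫ x, f x ∂(μ : Measure E) := by
  let κ : ProbabilityTheory.Kernel (ProbabilityMeasure E) E :=
    ⟨fun μ => (μ : Measure E), measurable_subtype_coe⟩
  have : ProbabilityTheory.IsMarkovKernel κ := ⟨fun μ => μ.2⟩
  exact (StronglyMeasurable.integral_kernel (κ := κ) hf).measurable

variable {E : Type*} [TopologicalSpace E] [TopologicalSpace.PseudoMetrizableSpace E]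
  [MeasurableSpace E] [BorelSpace E]

lemma measurable_toMeasure_borel :
    @Measurable (ProbabilityMeasure E) (Measure E) (borel _) _ (fun μ => (μ : Measure E)) := by
  let : MeasurableSpace (ProbabilityMeasure E) := borel _
  have : @BorelSpace (ProbabilityMeasure E) _ (borel _) := ⟨rfl⟩
  refine Measurable.measure_of_isPiSystem_of_isProbabilityMeasure
    (BorelSpace.measurable_eq (α := E)) isPiSystem_isOpen fun U hU => ?_
  refine LowerSemicontinuous.measurable ?_
  rw [lowerSemicontinuous_iff_le_liminf]
  intro μ
  exact ProbabilityMeasure.le_liminf_measure_open_of_tendsto tendsto_id hU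

/-- The Giry σ-algebra on probability measures is the Borel σ-algebra of weak convergence. -/
lemma borelSpace_probabilityMeasure [SecondCountableTopology (ProbabilityMeasure E)] :
    BorelSpace (ProbabilityMeasure E) := by
  refine ⟨le_antisymm ?_ ?_⟩
  · exact MeasurableSpace.comap_le_iff_le_map.2 measurable_toMeasure_borel
  · let s : Set (Set (ProbabilityMeasure E)) :=
      {A | ∃ (f : BoundedContinuousFunction E ℝ) (U : Set ℝ), IsOpen U ∧
        A = (fun μ : ProbabilityMeasure E => ∫ x, f x ∂(μ : Measure E)) ⁻¹' U}
    have hs : (inferInstance : TopologicalSpace (ProbabilityMeasure E)) = .generateFrom s := by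
      refine le_antisymm (le_generateFrom ?_) ?_
      · rintro _ ⟨f, U, hU, rfl⟩
        refine hU.preimage (continuous_iff_continuousAt.2 fun μ => ?_)
        exact ProbabilityMeasure.tendsto_iff_forall_integral_tendsto.1 tendsto_id f
      · refine le_of_nhds_le_nhds fun μ => ?_
        refine (ProbabilityMeasure.tendsto_iff_forall_integral_tendsto
          (F := @nhds _ (.generateFrom s) μ) (μs := id)).2 fun f => ?_
        have : @Continuous _ _ (.generateFrom s) _
            (fun μ : ProbabilityMeasure E => ∫ x, f x ∂(μ : Measure E)) :=
          continuous_def.2 fun U hU => TopologicalSpace.isOpen_generateFrom_of_mem ⟨f, U, hU, rfl⟩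
        exact @Continuous.continuousAt _ _ (.generateFrom s) _ _ _ this
    rw [borel_eq_generateFrom_of_subbasis hs]
    refine MeasurableSpace.generateFrom_le ?_
    rintro _ ⟨f, U, hU, rfl⟩
    exact measurable_integral_giry f.continuous.stronglyMeasurable hU.measurableSet

end Giry

section DeFinetti

/-- The mixture `∑ ω, w ω • δ_{Y ω}`. -/
noncomputable def mixture {Ω T : Type*} [Fintype Ω] [MeasurableSpace T] (w : Ω → ℝ) (Y : Ω → T) :
    Measure T :=
  ∑ ω, ENNReal.ofReal (w ω) • Measure.dirac (Y ω)

lemma isProbabilityMeasure_mixture {Ω T : Type*} [Fintype Ω] [MeasurableSpace T] {w : Ω → ℝ}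
    (hw0 : ∀ ω, 0 ≤ w ω) (hw1 : ∑ ω, w ω = 1) (Y : Ω → T) :
    IsProbabilityMeasure (mixture w Y) := by
  refine ⟨?_⟩
  simp only [mixture, Measure.coe_finsetSum, Finset.sum_apply, Measure.smul_apply, smul_eq_mul,
    measure_univ, mul_one]
  rw [← ENNReal.ofReal_sum_of_nonneg fun ω _ => hw0 ω, hw1, ENNReal.ofReal_one]

lemma integral_mixture {Ω T : Type*} [Fintype Ω] [MeasurableSpace T] {w : Ω → ℝ}
    (hw0 : ∀ ω, 0 ≤ w ω) (Y : Ω → T) {f : T → ℝ} (hf : StronglyMeasurable f) :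
    ∫ t, f t ∂(mixture w Y) = ∑ ω, w ω * f (Y ω) := by
  rw [mixture, integral_finsetSum_measure]
  · refine Finset.sum_congr rfl fun ω _ => ?_
    rw [integral_smul_measure, integral_dirac' _ _ hf, ENNReal.toReal_ofReal (hw0 ω), smul_eq_mul]
  · intro ω _
    refine Integrable.smul_measure ?_ ENNReal.ofReal_ne_top
    exact integrable_dirac' hf (by simp)

/-- The empirical measure of a nonempty finite vector. -/
noncomputable def empirical {E : Type*} [MeasurableSpace E] {n : ℕ} [NeZero n] (X : Fin n → E) :
    ProbabilityMeasure E :=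
  ⟨(PMF.uniformOfFintype (Fin n)).toMeasure.map X,
    Measure.isProbabilityMeasure_map (measurable_of_finite X).aemeasurable⟩

lemma integral_pi_empirical {E : Type*} [MeasurableSpace E] {n k : ℕ} [NeZero n]
    (X : Fin n → E) {φ : (Fin k → E) → ℝ} (hφ : StronglyMeasurable φ) :
    ∫ v, φ v ∂(Measure.pi fun _ : Fin k => (empirical X : Measure E)) =
      ((n : ℝ) ^ k)⁻¹ * ∑ f : Fin k → Fin n, φ (X ∘ f) := by
  set ν : Measure (Fin n) := (PMF.uniformOfFintype (Fin n)).toMeasure with hν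
  have hX : Measurable X := measurable_of_finite X
  have hprob : IsProbabilityMeasure (ν.map X) :=
    Measure.isProbabilityMeasure_map hX.aemeasurable
  have h1 : (Measure.pi fun _ : Fin k => (empirical X : Measure E)) =
      (Measure.pi fun _ : Fin k => ν).map fun v i => X (v i) :=
    (Measure.pi_map_pi (hμ := fun _ => inferInstance) fun _ => hX.aemeasurable).symm
  rw [h1, integral_map (measurable_of_finite _).aemeasurable hφ.aestronglyMeasurable,
    integral_fintype (Integrable.of_finite), Finset.mul_sum]
  refine Finset.sum_congr rfl fun f _ => ?_
  have h2 : ∀ i, ν {i} = (n : ENNReal)⁻¹ := by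
    intro i
    rw [hν, PMF.toMeasure_apply_singleton _ _ (measurableSet_singleton _)]
    simp
  rw [Measure.real, Measure.pi_singleton]
  simp [h2, Function.comp_def]

lemma card_filter_not_injective (n k : ℕ) :
    ((univ.filter fun f : Fin k → Fin n => ¬ Function.Injective f).card : ℝ) =
      (n : ℝ) ^ k - n.descFactorial k := by
  have h1 := Finset.card_filter_add_card_filter_not (s := (univ : Finset (Fin k → Fin n)))
    (p := fun f => Function.Injective f)
  have h2 : (univ.filter fun f : Fin k → Fin n => Function.Injective f).card =
      n.descFactorial k := by
    rw [← Fintype.card_subtype, Fintype.card_congr (Equiv.subtypeInjectiveEquivEmbedding _ _),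
      Fintype.card_embedding_eq]
    simp
  rw [h2] at h1
  simp only [Finset.card_univ, Fintype.card_pi, Fintype.card_fin, Finset.prod_const] at h1
  rw [← Nat.cast_pow, ← h1]
  push_cast
  ring

lemma exists_perm_comp_eq {n k : ℕ} {f f' : Fin k → Fin n} (hf : Function.Injective f)
    (hf' : Function.Injective f') : ∃ σ : Equiv.Perm (Fin n), σ ∘ f = f' := by
  have := Equiv.Perm.isMultiplyPretransitive (Fin n) k
  obtain ⟨σ, hσ⟩ := MulAction.exists_smul_eq (Equiv.Perm (Fin n))
    (⟨f, hf⟩ : Fin k ↪ Fin n) ⟨f', hf'⟩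
  exact ⟨σ, funext fun l => congrArg (fun e : Fin k ↪ Fin n => e l) hσ⟩

/-- Finite de Finetti bound: sampling from an exchangeable vector without replacement is close to
sampling from its empirical measure. -/
lemma abs_sampling_sub_le {E Ω : Type*} [MeasurableSpace E] [Fintype Ω] {n k : ℕ} [NeZero n]
    {w : Ω → ℝ} (hw0 : ∀ ω, 0 ≤ w ω) (hw1 : ∑ ω, w ω = 1) (X : Ω → Fin n → E)
    (hex : ∀ (σ : Equiv.Perm (Fin n)) (f : (Fin n → E) → ℝ),
      ∑ ω, w ω * f (X ω ∘ σ) = ∑ ω, w ω * f (X ω))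
    {φ : (Fin k → E) → ℝ} (hφ : StronglyMeasurable φ) {C : ℝ} (hC : ∀ v, |φ v| ≤ C)
    {f₀ : Fin k → Fin n} (hf₀ : Function.Injective f₀) :
    |∑ ω, w ω * φ (X ω ∘ f₀) -
      ∑ ω, w ω * ∫ v, φ v ∂(Measure.pi fun _ : Fin k => (empirical (X ω) : Measure E))| ≤
      2 * C * (1 - n.descFactorial k / (n : ℝ) ^ k) := by
  have hn : (0 : ℝ) < (n : ℝ) ^ k := by
    have : (0 : ℝ) < n := Nat.cast_pos.2 (NeZero.pos n)
    positivity
  set a : (Fin k → Fin n) → ℝ := fun f => ∑ ω, w ω * φ (X ω ∘ f) with ha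
  have haC : ∀ f, |a f| ≤ C := by
    intro f
    calc |a f| ≤ ∑ ω, |w ω * φ (X ω ∘ f)| := Finset.abs_sum_le_sum_abs _ _
      _ ≤ ∑ ω, w ω * C := by
        refine Finset.sum_le_sum fun ω _ => ?_
        rw [abs_mul, abs_of_nonneg (hw0 ω)]
        exact mul_le_mul_of_nonneg_left (hC _) (hw0 ω)
      _ = C := by rw [← Finset.sum_mul, hw1, one_mul]
  have hinj : ∀ f, Function.Injective f → a f = a f₀ := by
    intro f hf
    obtain ⟨σ, rfl⟩ := exists_perm_comp_eq hf₀ hf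
    exact hex σ fun v => φ (v ∘ f₀)
  have hterm : ∀ f, |a f₀ - a f| ≤ if ¬ Function.Injective f then 2 * C else 0 := by
    intro f
    split_ifs with h
    · simp [hinj f h]
    · calc |a f₀ - a f| ≤ |a f₀| + |a f| := abs_sub _ _
        _ ≤ 2 * C := by linarith [haC f₀, haC f]
  have havg : ∑ ω, w ω * ∫ v, φ v ∂(Measure.pi fun _ : Fin k => (empirical (X ω) : Measure E)) =
      ((n : ℝ) ^ k)⁻¹ * ∑ f, a f := by
    simp only [integral_pi_empirical _ hφ, ha]
    rw [Finset.sum_comm, Finset.mul_sum]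
    refine Finset.sum_congr rfl fun ω _ => ?_
    rw [← Finset.mul_sum]
    ring
  have hdiff : a f₀ - ((n : ℝ) ^ k)⁻¹ * ∑ f, a f = ((n : ℝ) ^ k)⁻¹ * ∑ f, (a f₀ - a f) := by
    rw [Finset.sum_sub_distrib, Finset.sum_const, Finset.card_univ, nsmul_eq_mul]
    simp only [Fintype.card_pi, Fintype.card_fin, Finset.prod_const, Finset.card_univ,
      Nat.cast_pow]
    field_simp
  rw [havg]
  change |a f₀ - _| ≤ _
  rw [hdiff, abs_mul, abs_of_pos (inv_pos.2 hn)]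
  calc ((n : ℝ) ^ k)⁻¹ * |∑ f, (a f₀ - a f)|
      ≤ ((n : ℝ) ^ k)⁻¹ * ∑ f : Fin k → Fin n, if ¬ Function.Injective f then 2 * C else 0 := by
        refine mul_le_mul_of_nonneg_left ?_ (inv_pos.2 hn).le
        exact (Finset.abs_sum_le_sum_abs _ _).trans (Finset.sum_le_sum fun f _ => hterm f)
    _ = 2 * C * (1 - n.descFactorial k / (n : ℝ) ^ k) := by
        rw [← Finset.sum_filter, Finset.sum_const, nsmul_eq_mul, card_filter_not_injective]
        field_simp

lemma tendsto_one_sub_descFactorial_div_pow (k : ℕ) :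
    Tendsto (fun n : ℕ => 1 - (n.descFactorial k : ℝ) / (n : ℝ) ^ k) atTop (𝓝 0) := by
  have h := (Asymptotics.isEquivalent_iff_tendsto_one (u := fun n : ℕ => (n.descFactorial k : ℝ))
    (v := fun n : ℕ => (n : ℝ) ^ k) ?_).1 (isEquivalent_descFactorial k)
  · simpa using h.const_sub 1
  · filter_upwards [eventually_gt_atTop 0] with n hn
    positivity

/-- Subsequential de Finetti theorem for arrays of finite exchangeable vectors in a compact
metrizable space. -/
lemma exists_subseq_deFinetti {E : Type*} [TopologicalSpace E] [T2Space E] [CompactSpace E]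
    [SecondCountableTopology E] [MeasurableSpace E] [BorelSpace E]
    (n : ℕ → ℕ) (hn : StrictMono n) [∀ j, NeZero (n j)]
    (Ω : ℕ → Type*) [∀ j, Fintype (Ω j)] (w : ∀ j, Ω j → ℝ) (hw0 : ∀ j ω, 0 ≤ w j ω)
    (hw1 : ∀ j, ∑ ω, w j ω = 1) (X : ∀ j, Ω j → Fin (n j) → E)
    (hex : ∀ j (σ : Equiv.Perm (Fin (n j))) (f : (Fin (n j) → E) → ℝ),
      ∑ ω, w j ω * f (X j ω ∘ σ) = ∑ ω, w j ω * f (X j ω)) :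
    ∃ s : ℕ → ℕ, StrictMono s ∧ ∃ S : Measure (ProbabilityMeasure E), IsProbabilityMeasure S ∧
      ∀ (k : ℕ) (idx : Fin k → ℕ), Function.Injective idx →
        ∀ φ : (Fin k → E) → ℝ, Continuous φ →
          Tendsto (fun j => if h : ∀ l, idx l < n (s j) then
              ∑ ω, w (s j) ω * φ (fun l => X (s j) ω ⟨idx l, h l⟩) else 0) atTop
            (𝓝 (∫ ρ, (∫ v, φ v ∂(Measure.pi fun _ : Fin k => (ρ : Measure E))) ∂S)) := by
  have : BorelSpace (ProbabilityMeasure E) := borelSpace_probabilityMeasure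
  let P : ℕ → ProbabilityMeasure (ProbabilityMeasure E) := fun j =>
    ⟨mixture (w j) fun ω => empirical (X j ω), isProbabilityMeasure_mixture (hw0 j) (hw1 j) _⟩
  obtain ⟨S, s, hs, hlim⟩ := CompactSpace.tendsto_subseq P
  refine ⟨s, hs, S, S.2, fun k idx hidx φ hφ => ?_⟩
  let φb : BoundedContinuousFunction (Fin k → E) ℝ := BoundedContinuousFunction.mkOfCompact ⟨φ, hφ⟩
  let Φ : ProbabilityMeasure E → ℝ :=
    fun ρ => ∫ v, φ v ∂(Measure.pi fun _ : Fin k => (ρ : Measure E))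
  have hΦ : Continuous Φ := by
    have h1 : Continuous fun ρ : ProbabilityMeasure E =>
        ProbabilityMeasure.pi fun _ : Fin k => ρ :=
      ProbabilityMeasure.continuous_pi.comp (continuous_pi fun _ => continuous_id)
    refine continuous_iff_continuousAt.2 fun ρ => ?_
    exact ProbabilityMeasure.tendsto_iff_forall_integral_tendsto.1 (h1.tendsto ρ) φb
  have hmain : Tendsto (fun j => ∑ ω, w (s j) ω * Φ (empirical (X (s j) ω))) atTop
      (𝓝 (∫ ρ, Φ ρ ∂(S : Measure (ProbabilityMeasure E)))) := by
    have h := ProbabilityMeasure.tendsto_iff_forall_integral_tendsto.1 hlim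
      (BoundedContinuousFunction.mkOfCompact ⟨Φ, hΦ⟩)
    refine h.congr fun j => ?_
    exact integral_mixture (hw0 (s j)) _ hΦ.stronglyMeasurable
  have hbd : Tendsto (fun j => 2 * ‖φb‖ *
      (1 - ((n (s j)).descFactorial k : ℝ) / (n (s j) : ℝ) ^ k)) atTop (𝓝 0) := by
    have h := ((tendsto_one_sub_descFactorial_div_pow k).comp
      (hn.comp hs).tendsto_atTop).const_mul (2 * ‖φb‖)
    rwa [mul_zero] at h
  have hev : ∀ᶠ j in atTop, ∀ l, idx l < n (s j) := by
    rw [eventually_all]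
    exact fun l => (hn.comp hs).tendsto_atTop.eventually_gt_atTop (idx l)
  have hdiff : Tendsto (fun j => (if h : ∀ l, idx l < n (s j) then
      ∑ ω, w (s j) ω * φ (fun l => X (s j) ω ⟨idx l, h l⟩) else 0) -
        ∑ ω, w (s j) ω * Φ (empirical (X (s j) ω))) atTop (𝓝 0) := by
    refine squeeze_zero_norm' ?_ hbd
    filter_upwards [hev] with j hj
    rw [dif_pos hj, Real.norm_eq_abs]
    exact abs_sampling_sub_le (hw0 _) (hw1 _) _ (hex _) hφ.stronglyMeasurable
      (fun v => φb.norm_coe_le_norm v) (f₀ := fun l => ⟨idx l, hj l⟩)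
      fun a b hab => hidx (by simpa using hab)
  simpa using hdiff.add hmain

end DeFinetti

section IidVec

variable {𝒳 : Type*} [Fintype 𝒳]

instance compactSpace_MX : CompactSpace (MX 𝒳) :=
  isCompact_iff_compactSpace.1 (isCompact_stdSimplex ℝ 𝒳)

lemma iidVec_eq_pi (ρ : Measure (MX 𝒳)) [IsProbabilityMeasure ρ] (k : ℕ) :
    iidVec ρ k = Measure.pi fun _ : Fin k => ρ := by
  induction k with
  | zero =>
    rw [iidVec, Measure.pi_of_empty]
    congr 1
  | succ k ih =>
    have hcons : Measurable fun q : MX 𝒳 × (Fin k → MX 𝒳) =>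
        (Fin.cons q.1 q.2 : Fin (k + 1) → MX 𝒳) := by
      refine measurable_pi_iff.2 fun i => ?_
      refine Fin.cases ?_ (fun i => ?_) i
      · exact measurable_fst
      · exact (measurable_pi_apply i).comp measurable_snd
    have h1 := (measurePreserving_piFinSuccAbove (fun _ : Fin (k + 1) => ρ) 0).symm.map_eq
    have h2 : ⇑(MeasurableEquiv.piFinSuccAbove (fun _ : Fin (k + 1) => MX 𝒳) 0).symm =
        fun q => (Fin.cons q.1 q.2 : Fin (k + 1) → MX 𝒳) := by
      funext q
      simp [MeasurableEquiv.piFinSuccAbove, Fin.insertNthEquiv]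
    rw [h2] at h1
    rw [← h1, iidVec, ih, Measure.prod]
    ext A hA
    rw [Measure.map_apply hcons hA]
    have hmk : Measurable fun ν : MX 𝒳 =>
        (Measure.pi fun _ : Fin k => ρ).map (Prod.mk ν) := Measurable.map_prodMk_left
    have heq : (fun ν : MX 𝒳 => (Measure.pi fun _ : Fin k => ρ).map
          fun v => (Fin.cons ν v : Fin (k + 1) → MX 𝒳)) =
        fun ν => ((Measure.pi fun _ : Fin k => ρ).map (Prod.mk ν)).map
          fun q => (Fin.cons q.1 q.2 : Fin (k + 1) → MX 𝒳) := by
      funext ν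
      rw [Measure.map_map hcons measurable_prodMk_left]
      rfl
    have hmap : Measurable fun ν : MX 𝒳 => ((Measure.pi fun _ : Fin k => ρ).map (Prod.mk ν)).map
        fun q => (Fin.cons q.1 q.2 : Fin (k + 1) → MX 𝒳) :=
      (Measure.measurable_map _ hcons).comp hmk
    rw [heq, Measure.bind_apply hA hmap.aemeasurable,
      Measure.bind_apply (hcons hA) hmk.aemeasurable]
    refine lintegral_congr fun ν => ?_
    rw [Measure.map_apply hcons hA]

end IidVec

section Observation

lemma sum_pert {𝒳 : Type*} [Fintype 𝒳] [DecidableEq 𝒳] (θ : ℝ) (x : 𝒳) : ∑ o : Option 𝒳, pert θ o x = 1 := by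
  simp [Fintype.sum_option, pert]

lemma pert_zero_nonneg {𝒳 : Type*} [DecidableEq 𝒳] (o : Option 𝒳) (x : 𝒳) : 0 ≤ pert 0 o x := by
  unfold pert
  split_ifs <;> norm_num

lemma sum_pi_prod {ι α : Type*} [Fintype ι] [DecidableEq ι] [Fintype α] (f : ι → α → ℝ) :
    ∑ v : ι → α, ∏ i, f i (v i) = ∏ i, ∑ a, f i a := by
  rw [Finset.prod_univ_sum, Fintype.piFinset_univ]

lemma sum_comp_perm {V 𝒳 : Type*} [Fintype V] [Fintype 𝒳] [DecidableEq V] (σ : Equiv.Perm V) (f : (V → 𝒳) → ℝ) :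
    ∑ x : V → 𝒳, f (x ∘ σ) = ∑ x, f x :=
  Equiv.sum_comp (σ.symm.arrowCongr (Equiv.refl 𝒳)) f

lemma jointSub_nonneg {V F 𝒳 𝒴 𝒵 : Type*} [Fintype V] [Fintype F] [Fintype 𝒳] [Fintype 𝒴]
    [Fintype 𝒵] [DecidableEq 𝒳] {p : 𝒳 → ℝ} {Q : F → 𝒴 → (V → 𝒳) → ℝ} {R : 𝒵 → 𝒳 → ℝ}
    (hp : IsPdist p) (hQ : IsKernelQ Q) (hR : IsKernelR R)
    (x : V → 𝒳) (y : F → 𝒴) (z : V → 𝒵 × Option 𝒳) :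
    0 ≤ jointSub p Q R (fun _ => 0) univ univ x y z :=
  mul_nonneg (mul_nonneg (Finset.prod_nonneg fun _ _ => hp.1 _)
    (Finset.prod_nonneg fun _ _ => hQ.1 _ _ _))
    (Finset.prod_nonneg fun _ _ => mul_nonneg (hR.1 _ _) (pert_zero_nonneg _ _))

lemma jointSub_comp_perm {V F 𝒳 𝒴 𝒵 : Type*} [Fintype V] [Fintype F] [DecidableEq 𝒳]
    (p : 𝒳 → ℝ) {Q Q' : F → 𝒴 → (V → 𝒳) → ℝ} (R : 𝒵 → 𝒳 → ℝ) (θ : ℝ)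
    (σ : Equiv.Perm V) (hQ : ∀ a y (x : V → 𝒳), Q' a y (x ∘ σ) = Q a y x)
    (x : V → 𝒳) (y : F → 𝒴) (z : V → 𝒵 × Option 𝒳) :
    jointSub p Q' R (fun _ => θ) univ univ (x ∘ σ) y (z ∘ σ) =
      jointSub p Q R (fun _ => θ) univ univ x y z := by
  simp only [jointSub, hQ, Function.comp_apply]
  rw [Equiv.prod_comp σ fun i => p (x i),
    Equiv.prod_comp σ fun i => R (z i).1 (x i) * pert θ (z i).2 (x i)]

variable {V F 𝒳 𝒴 𝒵 : Type*} [Fintype V] [Fintype F] [Fintype 𝒳] [Fintype 𝒴] [Fintype 𝒵]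
  [DecidableEq V] [DecidableEq F] [DecidableEq 𝒳]

lemma sum_jointSub {p : 𝒳 → ℝ} {Q : F → 𝒴 → (V → 𝒳) → ℝ} {R : 𝒵 → 𝒳 → ℝ}
    (hp : IsPdist p) (hQ : IsKernelQ Q) (hR : IsKernelR R) (θv : V → ℝ) :
    ∑ y : F → 𝒴, ∑ z : V → 𝒵 × Option 𝒳, ∑ x : V → 𝒳, jointSub p Q R θv univ univ x y z = 1 := by
  have hz : ∀ x : V → 𝒳, ∑ z : V → 𝒵 × Option 𝒳,
      ∏ i, (R (z i).1 (x i) * pert (θv i) (z i).2 (x i)) = 1 := by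
    intro x
    rw [sum_pi_prod fun i (q : 𝒵 × Option 𝒳) => R q.1 (x i) * pert (θv i) q.2 (x i)]
    refine Finset.prod_eq_one fun i _ => ?_
    rw [Fintype.sum_prod_type]
    simp only [← Finset.mul_sum, sum_pert, mul_one]
    exact hR.2 _
  have hy : ∀ x : V → 𝒳, ∑ y : F → 𝒴, ∏ a, Q a (y a) x = 1 := by
    intro x
    rw [sum_pi_prod fun a b => Q a b x]
    exact Finset.prod_eq_one fun a _ => hQ.2 a x
  have hx : ∑ x : V → 𝒳, ∏ i, p (x i) = 1 := by
    rw [sum_pi_prod fun _ b => p b]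
    exact Finset.prod_eq_one fun _ _ => hp.2
  calc ∑ y : F → 𝒴, ∑ z : V → 𝒵 × Option 𝒳, ∑ x : V → 𝒳, jointSub p Q R θv univ univ x y z
      = ∑ y : F → 𝒴, ∑ x : V → 𝒳, ∑ z : V → 𝒵 × Option 𝒳, jointSub p Q R θv univ univ x y z :=
        Finset.sum_congr rfl fun y _ => Finset.sum_comm
    _ = ∑ x : V → 𝒳, ∑ y : F → 𝒴, (∏ i, p (x i)) * ∏ a, Q a (y a) x := by
        rw [Finset.sum_comm]
        refine Finset.sum_congr rfl fun x _ => Finset.sum_congr rfl fun y _ => ?_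
        simp only [jointSub]
        rw [← Finset.mul_sum, hz, mul_one]
    _ = 1 := by simp only [← Finset.mul_sum, hy, mul_one, hx]

lemma margMX_comp_perm [DecidableEq 𝒴] [Nonempty 𝒳] (p : 𝒳 → ℝ) {Q Q' : F → 𝒴 → (V → 𝒳) → ℝ} (R : 𝒵 → 𝒳 → ℝ)
    (θ : ℝ) (σ : Equiv.Perm V) (hQ : ∀ a y (x : V → 𝒳), Q' a y (x ∘ σ) = Q a y x)
    (i : V) (y : F → 𝒴) (z : V → 𝒵 × Option 𝒳) :
    margMX p Q' R (fun _ => θ) univ univ i y (z ∘ σ) =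
      margMX p Q R (fun _ => θ) univ univ (σ i) y z := by
  unfold margMX
  congr 1
  funext ξ
  rw [← sum_comp_perm σ]
  simp only [jointSub_comp_perm p R θ σ hQ, Function.comp_apply]

end Observation

/-- Lemma 7.1 of the paper: de Finetti-type representation of the
conditional marginals.  For each `n`, let `G_n` be a random bipartite graph on variable
nodes `[n]` and function nodes `[m n]` whose distribution `W n` is invariant under
permutations of the variable nodes, carrying an observation system (graph-equivariant
kernels `Qg`, single-variable kernels `R`), and let `μ_i ∈ 𝖬(𝒳)` be the conditional
marginals given `(Y, Z)`.  For every diverging sequence `R₀` there are a subsequence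
`R = R₀ ∘ s` and a probability distribution `S` on `𝖬²(𝒳)` such that for all `k`, all
distinct variable nodes `i(1), …, i(k)` and every bounded Lipschitz
`φ : 𝖬(𝒳)^k → ℝ`,
`lim_{n ∈ R} E_G E φ(μ_{i(1)}, …, μ_{i(k)}) = ∫ [∫ φ dρ^{⊗k}] S(dρ)`. -/
theorem statement_19 (𝒳 𝒴 𝒵 : Type) [Fintype 𝒳] [DecidableEq 𝒳] [Nonempty 𝒳]
    [Fintype 𝒴] [DecidableEq 𝒴] [Fintype 𝒵]
    (m : ℕ → ℕ)
    (p : ℕ → 𝒳 → ℝ) (hp : ∀ n, IsPdist (p n))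
    (R : ℕ → 𝒵 → 𝒳 → ℝ) (hR : ∀ n, IsKernelR (R n))
    (Qg : ∀ n : ℕ, (Fin n → Fin (m n) → Bool) → Fin (m n) → 𝒴 → (Fin n → 𝒳) → ℝ)
    (hQ : ∀ n g, IsKernelQ (Qg n g))
    (hQloc : ∀ n g, QLocal g (Qg n g))
    (hQsym : ∀ n g, QSym g (Qg n g))
    (hQequiv : ∀ (n : ℕ) (g : Fin n → Fin (m n) → Bool) (σ : Equiv.Perm (Fin n))
      (a : Fin (m n)) (y : 𝒴) (x : Fin n → 𝒳),
      Qg n (fun i b => g (σ i) b) a y (fun i => x (σ i)) = Qg n g a y x)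
    (W : ∀ n : ℕ, (Fin n → Fin (m n) → Bool) → ℝ)
    (hW0 : ∀ n g, 0 ≤ W n g) (hW1 : ∀ n, ∑ g, W n g = 1)
    (hWsym : ∀ (n : ℕ) (σ : Equiv.Perm (Fin n)) (g : Fin n → Fin (m n) → Bool),
      W n (fun i a => g (σ i) a) = W n g)
    (R₀ : ℕ → ℕ) (hR₀ : StrictMono R₀) :
    ∃ s : ℕ → ℕ, StrictMono s ∧
      ∃ S : MeasureTheory.Measure (MeasureTheory.Measure (MX 𝒳)),
        MeasureTheory.IsProbabilityMeasure S ∧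
        ∀ (k : ℕ) (idx : Fin k → ℕ), Function.Injective idx →
          ∀ φ : (Fin k → MX 𝒳) → ℝ,
            (∃ K, LipschitzWith K φ) → Bornology.IsBounded (Set.range φ) →
            Filter.Tendsto
              (fun j : ℕ =>
                if h : ∀ l, idx l < R₀ (s j) then
                  ∑ g : Fin (R₀ (s j)) → Fin (m (R₀ (s j))) → Bool,
                    W (R₀ (s j)) g *
                      expObs (p (R₀ (s j))) (Qg (R₀ (s j)) g) (R (R₀ (s j)))
                        (fun _ => (0:ℝ)) (fun y z =>
                        φ fun l =>
                          margMX (p (R₀ (s j))) (Qg (R₀ (s j)) g) (R (R₀ (s j)))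
                            (fun _ => (0:ℝ)) univ univ ⟨idx l, h l⟩ y z)
                else 0)
              Filter.atTop
              (𝓝 (∫ ρ, (∫ v, φ v ∂(iidVec ρ k)) ∂S)) := by
  have hR₁ : StrictMono fun j => R₀ (j + 1) := fun a b hab => hR₀ (Nat.succ_lt_succ hab)
  have hne : ∀ j, NeZero (R₀ (j + 1)) := fun j =>
    ⟨(lt_of_le_of_lt (Nat.zero_le _) (hR₀ (Nat.lt_succ_self j))).ne'⟩
  let Ω : ℕ → Type := fun j => (Fin (R₀ (j + 1)) → Fin (m (R₀ (j + 1))) → Bool) ×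
    (Fin (m (R₀ (j + 1))) → 𝒴) × (Fin (R₀ (j + 1)) → 𝒵 × Option 𝒳)
  let w : ∀ j, Ω j → ℝ := fun j ω => W _ ω.1 * ∑ x, jointSub (p (R₀ (j + 1)))
    (Qg (R₀ (j + 1)) ω.1) (R (R₀ (j + 1))) (fun _ => (0 : ℝ)) univ univ x ω.2.1 ω.2.2
  let X : ∀ j, Ω j → Fin (R₀ (j + 1)) → MX 𝒳 := fun j ω i => margMX (p (R₀ (j + 1)))
    (Qg (R₀ (j + 1)) ω.1) (R (R₀ (j + 1))) (fun _ => (0 : ℝ)) univ univ i ω.2.1 ω.2.2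
  have hexp : ∀ j (f : Ω j → ℝ), ∑ ω, w j ω * f ω = ∑ g, W (R₀ (j + 1)) g *
      expObs (p (R₀ (j + 1))) (Qg (R₀ (j + 1)) g) (R (R₀ (j + 1))) (fun _ => (0 : ℝ))
        fun y z => f (g, y, z) := by
    intro j f
    rw [Fintype.sum_prod_type]
    refine Finset.sum_congr rfl fun g _ => ?_
    rw [Fintype.sum_prod_type]
    rw [expObs, Finset.mul_sum]
    refine Finset.sum_congr rfl fun y _ => ?_
    rw [Finset.mul_sum]
    exact Finset.sum_congr rfl fun z _ => mul_assoc _ _ _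
  have hw0 : ∀ j ω, 0 ≤ w j ω := fun j ω => mul_nonneg (hW0 _ _)
    (Finset.sum_nonneg fun x _ => jointSub_nonneg (hp _) (hQ _ _) (hR _) _ _ _)
  have hw1 : ∀ j, ∑ ω, w j ω = 1 := by
    intro j
    have h := hexp j fun _ => 1
    simp only [mul_one, expObs, sum_jointSub (hp _) (hQ _ _) (hR _), hW1] at h
    exact h
  have hex : ∀ j (σ : Equiv.Perm (Fin (R₀ (j + 1)))) (f : (Fin (R₀ (j + 1)) → MX 𝒳) → ℝ),
      ∑ ω, w j ω * f (X j ω ∘ σ) = ∑ ω, w j ω * f (X j ω) := by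
    intro j σ f
    let e : Equiv.Perm (Ω j) := (σ.symm.arrowCongr (Equiv.refl _)).prodCongr
      ((Equiv.refl _).prodCongr (σ.symm.arrowCongr (Equiv.refl _)))
    rw [← Equiv.sum_comp e fun ω => w j ω * f (X j ω)]
    refine Finset.sum_congr rfl fun ω _ => ?_
    have hQσ : ∀ a y (x : Fin (R₀ (j + 1)) → 𝒳),
        Qg (R₀ (j + 1)) (fun i b => ω.1 (σ i) b) a y (x ∘ σ) = Qg (R₀ (j + 1)) ω.1 a y x :=
      hQequiv _ ω.1 σ
    have hwe : w j (e ω) = w j ω := by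
      change W _ (fun i a => ω.1 (σ i) a) * ∑ x, jointSub _ (Qg _ fun i a => ω.1 (σ i) a) _ _ _ _ x
        ω.2.1 (ω.2.2 ∘ σ) = W _ ω.1 * _
      rw [hWsym, ← sum_comp_perm σ]
      simp only [jointSub_comp_perm _ _ _ σ hQσ]
    have hXe : X j (e ω) = X j ω ∘ σ :=
      funext fun i => margMX_comp_perm _ _ _ σ hQσ i ω.2.1 ω.2.2
    rw [hwe, hXe]
  obtain ⟨s, hs, S, hS, hlim⟩ := exists_subseq_deFinetti _ hR₁ Ω w hw0 hw1 X hex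
  have hemb : MeasurableEmbedding fun ρ : ProbabilityMeasure (MX 𝒳) => (ρ : Measure (MX 𝒳)) :=
    MeasurableEmbedding.subtype_coe ProbabilityMeasure.measurableSet_isProbabilityMeasure
  refine ⟨fun j => s j + 1, fun a b hab => Nat.succ_lt_succ (hs hab),
    S.map fun ρ : ProbabilityMeasure (MX 𝒳) => (ρ : Measure (MX 𝒳)),
    Measure.isProbabilityMeasure_map hemb.measurable.aemeasurable, ?_⟩
  intro k idx hidx φ ⟨K, hK⟩ _
  rw [hemb.integral_map]
  simp only [iidVec_eq_pi]
  refine (hlim k idx hidx φ hK.continuous).congr fun j => ?_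
  by_cases h : ∀ l, idx l < R₀ (s j + 1)
  · rw [dif_pos h, dif_pos h]
    exact hexp (s j) fun ω => φ fun l => X (s j) ω ⟨idx l, h l⟩
  · rw [dif_neg h, dif_neg h]

end PaperObs
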